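/- arXiv:2302.12221 — 2 statements merged into one kernel-verified Lean document; each statement's English description precedes it below -/
import Mathlib

section
/- Let χ be a finite nonempty type equipped with an associative binary operation ⊕, let x ∈ χ satisfy x ⊕ x = x, and let p be a probability mass function on χ. If p^{⊛m}(z) converges to δ_x(z) as m → ∞ for every z ∈ χ (i.e., p belongs to the domain of attraction of the degenerate law at x), then ∑_{y : x ⊕ y = x} p(y) = 1. -/
open Finset Filter Topology

/-- Pseudo-convolution of two (probability mass) functions with respect to the
binary operation `op`: `(p ⊛ q)(z) = ∑_{(x,y) : x ⊕ y = z} p(x) q(y)`. -/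
noncomputable def pconv {χ : Type*} [Fintype χ] [DecidableEq χ]
    (op : χ → χ → χ) (p q : χ → ℝ) : χ → ℝ :=
  fun z => ∑ x : χ, ∑ y : χ, if op x y = z then p x * q y else 0

/-- `piter op p m` is the `(m+1)`-fold pseudo-convolution `p^{⊛(m+1)}`
(so `piter op p 0 = p^{⊛1} = p`). -/
noncomputable def piter {χ : Type*} [Fintype χ] [DecidableEq χ]
    (op : χ → χ → χ) (p : χ → ℝ) : ℕ → χ → ℝ
  | 0 => p
  | m + 1 => pconv op p (piter op p m)

/-- The expectation of `f` under a pseudo-convolution is a double sum. -/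
theorem sum_pconv_mul {χ : Type*} [Fintype χ] [DecidableEq χ]
    (op : χ → χ → χ) (p q f : χ → ℝ) :
    ∑ z, pconv op p q z * f z = ∑ a, ∑ b, p a * q b * f (op a b) := by
  simp only [pconv, Finset.sum_mul]
  rw [Finset.sum_comm]
  refine Finset.sum_congr rfl fun a _ => ?_
  rw [Finset.sum_comm]
  refine Finset.sum_congr rfl fun b _ => ?_
  simp [ite_mul]

theorem pconv_assoc {χ : Type*} [Fintype χ] [DecidableEq χ]
    (op : χ → χ → χ) (hassoc : ∀ x y z : χ, op (op x y) z = op x (op y z))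
    (p q r : χ → ℝ) :
    pconv op (pconv op p q) r = pconv op p (pconv op q r) := by
  funext z
  have hl : pconv op (pconv op p q) r z =
      ∑ w, pconv op p q w * ∑ c, if op w c = z then r c else 0 := by
    simp only [pconv, Finset.mul_sum, mul_ite, mul_zero]
  have hr : pconv op p (pconv op q r) z =
      ∑ a, p a * ∑ w, pconv op q r w * if op a w = z then 1 else 0 := by
    conv_lhs => rw [pconv]
    simp only [Finset.mul_sum, mul_ite, mul_zero, mul_one]
  rw [hl, hr, sum_pconv_mul]
  refine Finset.sum_congr rfl fun a _ => ?_
  rw [sum_pconv_mul, Finset.mul_sum]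
  refine Finset.sum_congr rfl fun b _ => ?_
  rw [Finset.mul_sum, Finset.mul_sum]
  refine Finset.sum_congr rfl fun c _ => ?_
  rw [hassoc]
  split_ifs <;> ring

theorem pconv_piter_self {χ : Type*} [Fintype χ] [DecidableEq χ]
    (op : χ → χ → χ) (hassoc : ∀ x y z : χ, op (op x y) z = op x (op y z))
    (p : χ → ℝ) (m : ℕ) : pconv op (piter op p m) p = piter op p (m + 1) := by
  induction m with
  | zero => rfl
  | succ m ih =>
    calc pconv op (pconv op p (piter op p m)) p
        = pconv op p (pconv op (piter op p m) p) := pconv_assoc op hassoc _ _ _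
      _ = piter op p (m + 2) := by rw [ih]; rfl

theorem tendsto_pconv_left {ι χ : Type*} [Fintype χ] [DecidableEq χ] {l : Filter ι}
    (op : χ → χ → χ) {u : ι → χ → ℝ} {q : χ → ℝ} (p : χ → ℝ)
    (h : ∀ z, Tendsto (fun i => u i z) l (𝓝 (q z))) (z : χ) :
    Tendsto (fun i => pconv op (u i) p z) l (𝓝 (pconv op q p z)) := by
  refine tendsto_finsetSum _ fun a _ => tendsto_finsetSum _ fun b _ => ?_
  split_ifs
  · exact (h a).mul_const _
  · exact tendsto_const_nhds

/-- If `x ⊕ x = x` and the pmf `p` belongs to the domain of attraction of the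
degenerate law at `x` (its pseudo-convolution powers converge pointwise to `δ_x`),
then `∑_{y : x ⊕ y = x} p(y) = 1`. -/
theorem domain_of_attraction_of_degenerate {χ : Type*} [Fintype χ] [DecidableEq χ] [Nonempty χ]
    (op : χ → χ → χ) (hassoc : ∀ x y z : χ, op (op x y) z = op x (op y z))
    (x : χ) (hx : op x x = x)
    (p : χ → ℝ) (hp0 : ∀ y, 0 ≤ p y) (hp1 : ∑ y : χ, p y = 1)
    (hlim : ∀ z : χ,
      Tendsto (fun m => piter op p m z) atTop (𝓝 (if z = x then (1 : ℝ) else 0))) :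
    ∑ y : χ, (if op x y = x then p y else 0) = 1 := by
  have h₁ := tendsto_pconv_left op p hlim x
  simp only [pconv_piter_self op hassoc] at h₁
  have h₂ := tendsto_nhds_unique h₁ ((tendsto_add_atTop_iff_nat 1).2 (hlim x))
  rw [if_pos rfl, pconv, Finset.sum_eq_single x] at h₂
  · simpa using h₂
  · intro a _ ha
    simp [ha]
  · simp
end

section
/- Let N be a prime number and let p be a probability mass function on ZMod N. Then p satisfies p * p = p (i.e., p is Z_N-stable) if and only if either p is the degenerate law at 0 (p = δ_0) or p is the uniform distribution on ZMod N (p(k) = 1/N for all k). -/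
open Finset

/-- Convolution of two (probability mass) functions on `ZMod N`:
`(p * q)(z) = ∑_{(x,y) : x + y = z} p(x) q(y)`. -/
noncomputable def zconv {N : ℕ} [NeZero N] (p q : ZMod N → ℝ) : ZMod N → ℝ :=
  fun z => ∑ x : ZMod N, ∑ y : ZMod N, if x + y = z then p x * q y else 0

theorem zconv_apply {N : ℕ} [NeZero N] (p q : ZMod N → ℝ) (z : ZMod N) :
    zconv p q z = ∑ x : ZMod N, p x * q (z - x) := by
  unfold zconv
  refine Finset.sum_congr rfl fun x _ => ?_
  rw [Finset.sum_eq_single (z - x)]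
  · simp
  · intro y _ hy
    exact if_neg fun h => hy (eq_sub_of_add_eq' h)
  · simp

/-- Maximum principle: the set of maximizers of a stable pmf is invariant under subtracting
elements of the support. -/
theorem apply_sub_eq_of_zconv_self {N : ℕ} [NeZero N] {p : ZMod N → ℝ}
    (hp0 : ∀ k, 0 ≤ p k) (hp1 : ∑ k : ZMod N, p k = 1) (h : zconv p p = p)
    {z a : ZMod N} (hz : ∀ k, p k ≤ p z) (ha : p a ≠ 0) : p (z - a) = p z := by
  have hsum : ∑ x : ZMod N, p x * (p z - p (z - x)) = 0 := by
    simp_rw [mul_sub]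
    rw [Finset.sum_sub_distrib, ← Finset.sum_mul, hp1, ← zconv_apply, h]
    ring
  have hterm := (Finset.sum_eq_zero_iff_of_nonneg fun x _ =>
    mul_nonneg (hp0 x) (sub_nonneg.2 (hz (z - x)))).1 hsum a (Finset.mem_univ a)
  exact (sub_eq_zero.1 ((mul_eq_zero.1 hterm).resolve_left ha)).symm

/-- For a prime `N`, a pmf `p` on `ZMod N` is `Z_N`-stable (`p * p = p`) if and
only if `p` is either the degenerate law at `0` or the uniform distribution on
`ZMod N`. -/
theorem zmod_prime_stable_iff (N : ℕ) (hprime : N.Prime) [NeZero N] (p : ZMod N → ℝ)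
    (hp0 : ∀ k, 0 ≤ p k) (hp1 : ∑ k : ZMod N, p k = 1) :
    zconv p p = p ↔
      (p = fun k => if k = 0 then (1 : ℝ) else 0) ∨ (p = fun _ => (1 : ℝ) / N) := by
  have : Fact N.Prime := ⟨hprime⟩
  constructor
  · intro h
    by_cases hsupp : ∃ a, a ≠ 0 ∧ p a ≠ 0
    · right
      obtain ⟨a, ha, hpa⟩ := hsupp
      obtain ⟨z, hz⟩ := Finite.exists_max p
      have hmul (n : ℕ) : p (z - n * a) = p z := by
        induction n with
        | zero => simp
        | succ n ih =>
          have hstep := apply_sub_eq_of_zconv_self hp0 hp1 h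
            (z := z - n * a) (fun k => ih ▸ hz k) hpa
          rw [← ih, ← hstep]
          congr 1
          push_cast
          ring
      have hconst (k : ZMod N) : p k = p z := by
        rw [← hmul ((z - k) / a).val, ZMod.natCast_zmod_val, div_mul_cancel₀ _ ha,
          sub_sub_cancel]
      have hN : (N : ℝ) * p z = 1 := by
        simpa [hconst, ZMod.card] using hp1
      funext k
      rw [hconst k]
      exact eq_one_div_of_mul_eq_one_right hN
    · left
      push Not at hsupp
      have h0 : p 0 = 1 := by
        rw [← hp1]
        exact (Finset.sum_eq_single 0 (fun b _ hb => hsupp b hb) (by simp)).symm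
      funext k
      split_ifs with hk
      · rw [hk, h0]
      · exact hsupp k hk
  · have hN : (N : ℝ) ≠ 0 := Nat.cast_ne_zero.2 hprime.ne_zero
    rintro (rfl | rfl) <;> funext z <;> rw [zconv_apply]
    · simp [sub_eq_zero]
    · simp [ZMod.card, hN]
end
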